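/- arXiv:1302.2357 — 2 statements merged into one kernel-verified Lean document; each statement's English description precedes it below -/
import Mathlib

section
/- Let P(k) = Σ_{j=1}^k gcd(j,k) and, for an integer s ≥ 2, P_s(k) = Σ_{i=1}^k gcd(i,k)^s, and let Δ = (1/12)·Π_p (1 − 5/p² + 5/p³ − 1/p⁵) and M(s) = Σ_{i,j≥1} (φ(i)/i^{1+s})·(φ(j)/j^{1+s})·gcd(i,j). Then: (a) liminf_{n→∞} (ln n)^{-3} · (1/n)·Σ_{k=1}^n (P(k)/k)² ≥ Δ; and (b) for each fixed s ≥ 2, lim_{n→∞} (1/n)·Σ_{k=1}^n (P_s(k)/k^s)² = M(s). -/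
open Filter

/-- The constant `Δ = (1/12) Π_p (1 − 5/p² + 5/p³ − 1/p⁵)`. -/
noncomputable def DeltaConst : ℝ :=
  (1 / 12) * ∏' p : Nat.Primes,
    (1 - 5 / ((p : ℕ) : ℝ) ^ 2 + 5 / ((p : ℕ) : ℝ) ^ 3 - 1 / ((p : ℕ) : ℝ) ^ 5)

/-- `M(s) = Σ_{i,j≥1} (φ(i)/i^{1+s})(φ(j)/j^{1+s}) gcd(i,j)`. -/
noncomputable def Mconst (s : ℕ) : ℝ :=
  ∑' p : ℕ+ × ℕ+,
    (Nat.totient p.1 : ℝ) / (p.1 : ℝ) ^ (1 + s) *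
      ((Nat.totient p.2 : ℝ) / (p.2 : ℝ) ^ (1 + s)) * (Nat.gcd p.1 p.2 : ℝ)

/-- Pillai's function `P(k) = Σ_{j=1}^k gcd(j,k)`. -/
def pillai (k : ℕ) : ℕ := ∑ j ∈ Finset.Icc 1 k, Nat.gcd j k

/-- The generalized Pillai function `P_s(k) = Σ_{i=1}^k gcd(i,k)^s`. -/
def pillaiPow (s k : ℕ) : ℕ := ∑ i ∈ Finset.Icc 1 k, Nat.gcd i k ^ s

open ArithmeticFunction ArithmeticFunction.zeta ArithmeticFunction.Moebius

/-- Upper tangent bound for the increments of a power. -/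
lemma pow_succ_sub_pow_succ_le {u v : ℝ} (hv : 0 ≤ v) (huv : v ≤ u) (j : ℕ) :
    u ^ (j + 1) - v ^ (j + 1) ≤ (j + 1) * (u - v) * u ^ j := by
  induction j with
  | zero => simp
  | succ j ih =>
    have h1 : v ^ (j + 1) ≤ u ^ (j + 1) := pow_le_pow_left₀ hv huv _
    have h2 := mul_le_mul_of_nonneg_left ih (hv.trans huv)
    have h3 := mul_le_mul_of_nonneg_left h1 (sub_nonneg.2 huv)
    have e1 : u ^ (j + 1 + 1) - v ^ (j + 1 + 1) =
        u * (u ^ (j + 1) - v ^ (j + 1)) + (u - v) * v ^ (j + 1) := by ring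
    have e2 : ((j + 1 : ℕ) + 1 : ℝ) * (u - v) * u ^ (j + 1) =
        u * ((j + 1) * (u - v) * u ^ j) + (u - v) * u ^ (j + 1) := by push_cast; ring
    rw [e1, e2]
    exact add_le_add h2 h3

/-- Lower tangent bound for the increments of a power. -/
lemma le_pow_succ_sub_pow_succ {u v : ℝ} (hv : 0 ≤ v) (huv : v ≤ u) (j : ℕ) :
    (j + 1) * (u - v) * v ^ j ≤ u ^ (j + 1) - v ^ (j + 1) := by
  induction j with
  | zero => simp
  | succ j ih =>
    have h1 : v ^ (j + 1) ≤ u ^ (j + 1) := pow_le_pow_left₀ hv huv _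
    have h2 := mul_le_mul_of_nonneg_left ih hv
    have h3 := mul_le_mul_of_nonneg_left h1 (sub_nonneg.2 huv)
    have e1 : u ^ (j + 1 + 1) - v ^ (j + 1 + 1) =
        v * (u ^ (j + 1) - v ^ (j + 1)) + (u - v) * u ^ (j + 1) := by ring
    have e2 : ((j + 1 : ℕ) + 1 : ℝ) * (u - v) * v ^ (j + 1) =
        v * ((j + 1) * (u - v) * v ^ j) + (u - v) * v ^ (j + 1) := by push_cast; ring
    rw [e1, e2]
    exact add_le_add h2 h3

lemma log_succ_sub_log_le {a : ℝ} (ha : 0 < a) : Real.log (a + 1) - Real.log a ≤ 1 / a := by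
  rw [← Real.log_div (by positivity) ha.ne']
  refine (Real.log_le_sub_one_of_pos (by positivity)).trans (le_of_eq ?_)
  field_simp
  ring

lemma one_div_succ_le_log_succ_sub_log {a : ℝ} (ha : 0 < a) :
    1 / (a + 1) ≤ Real.log (a + 1) - Real.log a := by
  have h := Real.log_le_sub_one_of_pos (x := a / (a + 1)) (by positivity)
  rw [Real.log_div ha.ne' (by positivity)] at h
  have e : a / (a + 1) - 1 = -(1 / (a + 1)) := by field_simp; ring
  linarith

lemma le_of_mem_Ioc_floor {y : ℝ} {a : ℕ} (ha : a ∈ Finset.Ioc 0 ⌊y⌋₊) : (a : ℝ) ≤ y := by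
  have h := Finset.mem_Ioc.1 ha
  exact (Nat.le_floor_iff' (by omega)).1 h.2

lemma pow_log_le_sum_pow_log_div {y : ℝ} (hy : 1 ≤ y) (j : ℕ) :
    Real.log y ^ (j + 1) / (j + 1) ≤
      ∑ a ∈ Finset.Ioc 0 ⌊y⌋₊, 1 / (a : ℝ) * Real.log (y / a) ^ j := by
  set u : ℕ → ℝ := fun a => max 0 (Real.log y - Real.log a) with hu
  have key : ∀ N : ℕ, u 1 ^ (j + 1) - u (N + 1) ^ (j + 1) ≤
      ∑ a ∈ Finset.Ioc 0 N, (j + 1) * (1 / (a : ℝ)) * u a ^ j := by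
    intro N
    induction N with
    | zero => simp
    | succ N ih =>
      rw [Finset.sum_Ioc_succ_top (Nat.zero_le N)]
      have hN : (0 : ℝ) < ((N + 1 : ℕ) : ℝ) := by positivity
      have hl := log_succ_sub_log_le hN
      have hm : Real.log ((N + 1 : ℕ) : ℝ) ≤ Real.log (((N + 1 : ℕ) : ℝ) + 1) :=
        Real.log_le_log hN (by linarith)
      have hle : u (N + 1 + 1) ≤ u (N + 1) := by
        simp only [hu]
        apply max_le_max le_rfl
        push_cast at hm ⊢
        linarith
      have hdiff : u (N + 1) - u (N + 1 + 1) ≤ 1 / ((N + 1 : ℕ) : ℝ) := by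
        have : u (N + 1) ≤ u (N + 1 + 1) + 1 / ((N + 1 : ℕ) : ℝ) := by
          simp only [hu]
          apply max_le
          · positivity
          · have := le_max_right 0 (Real.log y - Real.log ((N + 1 + 1 : ℕ) : ℝ))
            push_cast at hl this ⊢
            linarith
        linarith
      have h0 : 0 ≤ u (N + 1) := le_max_left _ _
      have h1 := pow_succ_sub_pow_succ_le (le_max_left 0 _ : 0 ≤ u (N + 1 + 1)) hle j
      have h2 : (j + 1) * (u (N + 1) - u (N + 1 + 1)) * u (N + 1) ^ j ≤
          (j + 1) * (1 / ((N + 1 : ℕ) : ℝ)) * u (N + 1) ^ j := by gcongr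
      linarith
  have hend : u (⌊y⌋₊ + 1) = 0 := by
    simp only [hu]
    apply max_eq_left
    have : Real.log y ≤ Real.log ((⌊y⌋₊ + 1 : ℕ) : ℝ) :=
      Real.log_le_log (by linarith) (by push_cast; exact (Nat.lt_floor_add_one y).le)
    linarith
  have hone : u 1 = Real.log y := by simp [hu, Real.log_nonneg hy]
  have h := key ⌊y⌋₊
  rw [hend, hone, zero_pow (by omega), sub_zero] at h
  rw [div_le_iff₀ (by positivity), Finset.sum_mul]
  refine h.trans (le_of_eq (Finset.sum_congr rfl fun a ha => ?_))
  have hay := le_of_mem_Ioc_floor ha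
  have ha0 : (0 : ℝ) < a := by exact_mod_cast (Finset.mem_Ioc.1 ha).1
  have : u a = Real.log (y / a) := by
    rw [Real.log_div (by linarith) ha0.ne']
    exact max_eq_right (sub_nonneg.2 (Real.log_le_log ha0 hay))
  rw [this]
  ring

lemma sum_pow_log_div_le {y c : ℝ} (hy : 1 ≤ y) (hc : 0 ≤ c) (j : ℕ) :
    ∑ a ∈ Finset.Ioc 0 ⌊y⌋₊, 1 / (a : ℝ) * (Real.log (y / a) + c) ^ j ≤
      (Real.log y + c + 1) ^ (j + 1) / (j + 1) := by
  have key : ∀ N : ℕ, 1 ≤ N → (N : ℝ) ≤ y →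
      ∑ a ∈ Finset.Ioc 0 N, 1 / (a : ℝ) * (Real.log (y / a) + c) ^ j ≤
        (Real.log y + c) ^ j +
          ((Real.log y + c) ^ (j + 1) - (Real.log (y / N) + c) ^ (j + 1)) / (j + 1) := by
    intro N hN
    induction N, hN using Nat.le_induction with
    | base => intro _; simp
    | succ N hN ih =>
      intro hNy
      rw [Finset.sum_Ioc_succ_top (Nat.zero_le N)]
      have hN0 : (0 : ℝ) < N := by exact_mod_cast hN
      push_cast at hNy ⊢
      have ih := ih (by linarith)
      have hl := one_div_succ_le_log_succ_sub_log hN0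
      have hv : 0 ≤ Real.log (y / (N + 1)) := Real.log_nonneg (by
        rw [le_div_iff₀ (by positivity)]; linarith)
      have e : 1 / ((N : ℝ) + 1) ≤ (Real.log (y / N) + c) - (Real.log (y / (N + 1)) + c) := by
        rw [Real.log_div (by linarith) hN0.ne', Real.log_div (by linarith) (by positivity)]
        linarith
      have hpos : 0 < 1 / ((N : ℝ) + 1) := by positivity
      have h1 := le_pow_succ_sub_pow_succ (add_nonneg hv hc) (by linarith) j
        (u := Real.log (y / N) + c)
      have h2 : 1 / ((N : ℝ) + 1) * (Real.log (y / (N + 1)) + c) ^ j ≤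
          ((Real.log (y / N) + c) ^ (j + 1) - (Real.log (y / (N + 1)) + c) ^ (j + 1))
            / (j + 1) := by
        rw [le_div_iff₀ (by positivity)]
        refine le_trans (le_of_eq_of_le ?_ (mul_le_mul_of_nonneg_right
          (mul_le_mul_of_nonneg_left e (by positivity : (0 : ℝ) ≤ j + 1)) (by positivity))) h1
        ring
      refine (add_le_add ih h2).trans (le_of_eq ?_)
      ring
  have hy0 : (0 : ℝ) ≤ Real.log y := Real.log_nonneg hy
  have h := key ⌊y⌋₊ ((Nat.one_le_floor_iff y).2 hy) (Nat.floor_le (by linarith))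
  have hlast : 0 ≤ Real.log (y / (⌊y⌋₊ : ℝ)) := Real.log_nonneg (by
    rw [le_div_iff₀ (by exact_mod_cast (Nat.one_le_floor_iff y).2 hy), one_mul]
    exact Nat.floor_le (by linarith))
  refine h.trans ?_
  have h1 := le_pow_succ_sub_pow_succ (add_nonneg hy0 hc) (by linarith) j
    (u := Real.log y + c + 1)
  have h2 : 0 ≤ (Real.log (y / (⌊y⌋₊ : ℝ)) + c) ^ (j + 1) := by positivity
  rw [le_div_iff₀ (by positivity), add_mul, div_mul_cancel₀ _ (by positivity)]
  ring_nf at h1 h2 ⊢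
  linarith

/-- The summatory function of the `j`-fold divisor function. -/
noncomputable def divisorSum (j : ℕ) (y : ℝ) : ℝ :=
  ∑ m ∈ Finset.Ioc 0 ⌊y⌋₊, ((ζ : ArithmeticFunction ℝ) ^ j : ArithmeticFunction ℝ) m

lemma divisorSum_nonneg (j : ℕ) (y : ℝ) : 0 ≤ divisorSum j y := by
  have key : ∀ m, 0 ≤ ((ζ : ArithmeticFunction ℝ) ^ j : ArithmeticFunction ℝ) m := by
    induction j with
    | zero => intro m; rw [pow_zero, one_apply]; split_ifs <;> norm_num
    | succ j ih =>
      intro m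
      rw [pow_succ, mul_apply]
      refine Finset.sum_nonneg fun x _ => mul_nonneg (ih _) ?_
      rw [natCoe_apply]
      positivity
  exact Finset.sum_nonneg fun m _ => key m

lemma divisorSum_one (y : ℝ) : divisorSum 1 y = ⌊y⌋₊ := by
  unfold divisorSum
  rw [pow_one]
  simp only [natCoe_apply]
  exact_mod_cast sum_Ioc_zeta ⌊y⌋₊

lemma divisorSum_succ (j : ℕ) (y : ℝ) :
    divisorSum (j + 1) y = ∑ a ∈ Finset.Ioc 0 ⌊y⌋₊, divisorSum j (y / a) := by
  unfold divisorSum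
  rw [pow_succ', sum_Ioc_mul_eq_sum_sum]
  refine Finset.sum_congr rfl fun a ha => ?_
  rw [natCoe_apply, zeta_apply_ne (by have := Finset.mem_Ioc.1 ha; omega), Nat.cast_one, one_mul,
    Nat.floor_div_natCast]

lemma one_le_div_of_mem {y : ℝ} {a : ℕ} (ha : a ∈ Finset.Ioc 0 ⌊y⌋₊) : 1 ≤ y / a := by
  have ha0 : (0 : ℝ) < a := by exact_mod_cast (Finset.mem_Ioc.1 ha).1
  rw [le_div_iff₀ ha0, one_mul]
  exact le_of_mem_Ioc_floor ha

lemma divisorSum_succ_le {y : ℝ} (hy : 1 ≤ y) (j : ℕ) :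
    divisorSum (j + 1) y ≤ y * ((Real.log y + j) ^ j / j.factorial) := by
  induction j generalizing y with
  | zero => simpa [divisorSum_one] using Nat.floor_le (by linarith : 0 ≤ y)
  | succ j ih =>
    rw [divisorSum_succ]
    have h1 := Finset.sum_le_sum fun a ha => ih (one_le_div_of_mem (y := y) (a := a) ha)
    refine h1.trans ?_
    have h2 := mul_le_mul_of_nonneg_left (sum_pow_log_div_le hy (Nat.cast_nonneg j) j)
      (by positivity : 0 ≤ y / j.factorial)
    refine le_trans (le_of_eq ?_) (h2.trans (le_of_eq ?_))
    · rw [Finset.mul_sum]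
      refine Finset.sum_congr rfl fun a _ => ?_
      ring
    · rw [Nat.factorial_succ]
      push_cast
      field_simp
      ring

lemma le_divisorSum_add_two {y : ℝ} (hy : 1 ≤ y) (j : ℕ) :
    y * (Real.log y ^ (j + 1) / (j + 1).factorial - (Real.log y + j) ^ j / j.factorial) ≤
      divisorSum (j + 2) y := by
  have hy0 : 0 < y := by linarith
  induction j generalizing y with
  | zero =>
    rw [divisorSum_succ]
    have h1 := mul_le_mul_of_nonneg_left (pow_log_le_sum_pow_log_div hy 0) hy0.le
    have h2 : ∑ a ∈ Finset.Ioc 0 ⌊y⌋₊, (y / a - 1) ≤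
        ∑ a ∈ Finset.Ioc 0 ⌊y⌋₊, divisorSum 1 (y / a) := by
      refine Finset.sum_le_sum fun a _ => ?_
      rw [divisorSum_one]
      exact (Nat.sub_one_lt_floor _).le
    have h3 : ∑ a ∈ Finset.Ioc 0 ⌊y⌋₊, (y / a - 1) =
        y * ∑ a ∈ Finset.Ioc 0 ⌊y⌋₊, 1 / (a : ℝ) * Real.log (y / a) ^ 0 - ⌊y⌋₊ := by
      rw [Finset.sum_sub_distrib, Finset.mul_sum]
      simp [div_eq_mul_inv]
    have h4 := Nat.floor_le hy0.le
    simp only [Nat.factorial, Nat.cast_zero, pow_zero] at *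
    norm_num at *
    linarith
  | succ j ih =>
    rw [divisorSum_succ]
    have h1 := Finset.sum_le_sum fun a ha => ih (one_le_div_of_mem (y := y) (a := a) ha)
      (by linarith [one_le_div_of_mem ha])
    refine le_trans ?_ h1
    have h2 := mul_le_mul_of_nonneg_left (pow_log_le_sum_pow_log_div hy (j + 1))
      (by positivity : 0 ≤ y / (j + 1).factorial)
    have h3 := mul_le_mul_of_nonneg_left (sum_pow_log_div_le hy (Nat.cast_nonneg j) j)
      (by positivity : 0 ≤ y / j.factorial)
    refine le_trans (le_of_eq ?_) ((sub_le_sub h2 h3).trans (le_of_eq ?_))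
    · rw [Nat.factorial_succ (j + 1), Nat.factorial_succ j]
      push_cast
      field_simp
      ring
    · rw [Finset.mul_sum, Finset.mul_sum, ← Finset.sum_sub_distrib]
      refine Finset.sum_congr rfl fun a _ => ?_
      ring

lemma tendsto_divisorSum_four :
    Tendsto (fun y : ℝ => divisorSum 4 y / (y * Real.log y ^ 3)) atTop (nhds (1 / 6)) := by
  have hlog := Real.tendsto_log_atTop
  have hinv : Tendsto (fun y : ℝ => (Real.log y)⁻¹) atTop (nhds 0) :=
    tendsto_inv_atTop_zero.comp hlog
  have hup : Tendsto (fun y : ℝ => (1 + 3 * (Real.log y)⁻¹) ^ 3 / 6) atTop (nhds (1 / 6)) := by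
    have := (((hinv.const_mul 3).const_add 1).pow 3).div_const 6
    simpa using this
  have hlo : Tendsto (fun y : ℝ => 1 / 6 - (1 + 2 * (Real.log y)⁻¹) ^ 2 / 2 * (Real.log y)⁻¹)
      atTop (nhds (1 / 6)) := by
    have := ((((hinv.const_mul 2).const_add 1).pow 2).div_const 2 |>.mul hinv).const_sub (1 / 6)
    simpa using this
  refine tendsto_of_tendsto_of_tendsto_of_le_of_le' hlo hup ?_ ?_
  · filter_upwards [eventually_gt_atTop 1] with y hy
    have hl := Real.log_pos hy
    have h := le_divisorSum_add_two hy.le 2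
    rw [le_div_iff₀ (by positivity)]
    refine le_trans (le_of_eq ?_) h
    norm_num [Nat.factorial]
    field_simp
  · filter_upwards [eventually_gt_atTop 1] with y hy
    have hl := Real.log_pos hy
    have h := divisorSum_succ_le hy.le 3
    rw [div_le_iff₀ (by positivity)]
    refine h.trans (le_of_eq ?_)
    norm_num [Nat.factorial]
    field_simp

lemma pillai_eq_pillaiPow_one (k : ℕ) : pillai k = pillaiPow 1 k := by
  simp [pillai, pillaiPow]

lemma pillaiPow_eq_sum_divisors (s : ℕ) {k : ℕ} (hk : 0 < k) :
    pillaiPow s k = ∑ d ∈ k.divisors, Nat.totient (k / d) * d ^ s := by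
  have h1 : pillaiPow s k = ∑ i ∈ Finset.range k, Nat.gcd k i ^ s := by
    unfold pillaiPow
    have e : Finset.Icc 1 k = Finset.Ico 1 (k + 1) := by
      ext
      simp only [Finset.mem_Icc, Finset.mem_Ico]
      omega
    have h2 := Finset.sum_range_succ (fun i => Nat.gcd i k ^ s) k
    have h3 := Finset.sum_range_succ' (fun i => Nat.gcd i k ^ s) k
    simp only [Nat.gcd_self, Nat.gcd_zero_left] at h2 h3
    rw [e, Finset.sum_Ico_eq_sum_range, Nat.add_sub_cancel]
    simp_rw [Nat.gcd_comm k, add_comm 1]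
    omega
  rw [h1, ← Finset.sum_fiberwise_of_maps_to (s := Finset.range k) (t := k.divisors)
    (g := fun i => Nat.gcd k i)
    (fun i _ => Nat.mem_divisors.2 ⟨Nat.gcd_dvd_left k i, hk.ne'⟩)]
  refine Finset.sum_congr rfl fun d hd => ?_
  rw [Nat.totient_div_of_dvd (Nat.dvd_of_mem_divisors hd), Finset.card_eq_sum_ones,
    Finset.sum_mul]
  refine Finset.sum_congr rfl fun i hi => ?_
  rw [(Finset.mem_filter.1 hi).2, one_mul]

lemma pillaiPow_div_pow (s : ℕ) {k : ℕ} (hk : 0 < k) :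
    (pillaiPow s k : ℝ) / (k : ℝ) ^ s = ∑ d ∈ k.divisors, (Nat.totient d : ℝ) / (d : ℝ) ^ s := by
  rw [pillaiPow_eq_sum_divisors s hk, ← Nat.sum_div_divisors, Nat.cast_sum, Finset.sum_div]
  refine Finset.sum_congr rfl fun d hd => ?_
  have hdk := Nat.dvd_of_mem_divisors hd
  have hd0 : (d : ℝ) ≠ 0 := by exact_mod_cast (Nat.pos_of_mem_divisors hd).ne'
  have hk0 : (k : ℝ) ≠ 0 := by exact_mod_cast hk.ne'
  rw [Nat.div_div_self hdk hk.ne']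
  push_cast [Nat.cast_div hdk hd0]
  rw [div_pow]
  field_simp

/-- The arithmetic function `n ↦ φ(n) / n`. -/
noncomputable def totientRatio : ArithmeticFunction ℝ :=
  ⟨fun n => (Nat.totient n : ℝ) / n, by simp⟩

lemma totientRatio_apply (n : ℕ) : totientRatio n = (Nat.totient n : ℝ) / n := rfl

lemma isMultiplicative_totientRatio : totientRatio.IsMultiplicative := by
  refine ⟨by simp [totientRatio_apply], fun {m n} h => ?_⟩
  simp only [totientRatio_apply, Nat.totient_mul h]
  push_cast
  rw [mul_div_mul_comm]

/-- The arithmetic function `n ↦ (P(n) / n)²`. -/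
noncomputable def pillaiSq : ArithmeticFunction ℝ :=
  pmul (totientRatio * ζ) (totientRatio * ζ)

lemma pillaiSq_apply {k : ℕ} (hk : 0 < k) : pillaiSq k = ((pillai k : ℝ) / k) ^ 2 := by
  have h := pillaiPow_div_pow 1 hk
  simp only [pow_one] at h
  rw [pillaiSq, pmul_apply, coe_mul_zeta_apply, pillai_eq_pillaiPow_one, h, sq]
  rfl

lemma isMultiplicative_pillaiSq : pillaiSq.IsMultiplicative :=
  have h := isMultiplicative_totientRatio.mul isMultiplicative_zeta.natCast
  h.pmul h

lemma pillaiSq_prime_pow {p : ℕ} (hp : p.Prime) (k : ℕ) :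
    pillaiSq (p ^ k) = (1 + k * (1 - 1 / (p : ℝ))) ^ 2 := by
  have hp0 : (p : ℝ) ≠ 0 := by exact_mod_cast hp.ne_zero
  rw [pillaiSq, pmul_apply, coe_mul_zeta_apply, Nat.sum_divisors_prime_pow hp,
    Finset.sum_range_succ', ← sq]
  have : ∀ i ∈ Finset.range k, totientRatio (p ^ (i + 1)) = 1 - 1 / (p : ℝ) := by
    intro i _
    rw [totientRatio_apply, Nat.totient_prime_pow_succ hp]
    push_cast [Nat.cast_sub hp.one_le]
    field_simp
    ring
  rw [Finset.sum_congr rfl this]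
  simp [totientRatio_apply]
  ring

lemma mul_moebius_prime_pow_succ (f : ArithmeticFunction ℝ) {p : ℕ} (hp : p.Prime) (k : ℕ) :
    (f * (μ : ArithmeticFunction ℝ)) (p ^ (k + 1)) = f (p ^ (k + 1)) - f (p ^ k) := by
  set g := f * (μ : ArithmeticFunction ℝ) with hg
  have hf : f = g * (ζ : ArithmeticFunction ℝ) := by
    rw [hg, mul_assoc, coe_moebius_mul_coe_zeta, mul_one]
  rw [hf, coe_mul_zeta_apply, coe_mul_zeta_apply, Nat.sum_divisors_prime_pow hp,
    Nat.sum_divisors_prime_pow hp, Finset.sum_range_succ]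
  ring

lemma mul_moebius_one (f : ArithmeticFunction ℝ) : (f * (μ : ArithmeticFunction ℝ)) 1 = f 1 := by
  simp

/-- The arithmetic function whose Dirichlet convolution with the fourfold divisor function is
`pillaiSq`. -/
noncomputable def pillaiCoeff : ArithmeticFunction ℝ :=
  pillaiSq * μ * μ * μ * μ

lemma isMultiplicative_pillaiCoeff : pillaiCoeff.IsMultiplicative :=
  have h := isMultiplicative_moebius.intCast (R := ℝ)
  (((isMultiplicative_pillaiSq.mul h).mul h).mul h).mul h

lemma pillaiCoeff_mul_zeta_pow :
    pillaiCoeff * (ζ : ArithmeticFunction ℝ) ^ 4 = pillaiSq := by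
  have e : pillaiCoeff * (ζ : ArithmeticFunction ℝ) ^ 4 =
      pillaiSq * (((μ : ArithmeticFunction ℝ) * (ζ : ArithmeticFunction ℝ)) ^ 4) := by
    rw [pillaiCoeff]; ring
  rw [e, coe_moebius_mul_coe_zeta, one_pow, mul_one]

lemma pillaiCoeff_prime {p : ℕ} (hp : p.Prime) :
    pillaiCoeff p = 1 / (p : ℝ) ^ 2 - 4 / p := by
  have hp0 : (p : ℝ) ≠ 0 := by exact_mod_cast hp.ne_zero
  have h : pillaiCoeff (p ^ (0 + 1)) = 1 / (p : ℝ) ^ 2 - 4 / p := by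
    simp only [pillaiCoeff, mul_moebius_prime_pow_succ _ hp, pow_zero, mul_moebius_one]
    simp only [← pow_zero p, pillaiSq_prime_pow hp]
    push_cast
    field_simp
    ring
  simpa using h

lemma pillaiCoeff_prime_sq {p : ℕ} (hp : p.Prime) :
    pillaiCoeff (p ^ 2) = 4 / (p : ℝ) - 1 := by
  have hp0 : (p : ℝ) ≠ 0 := by exact_mod_cast hp.ne_zero
  have h : pillaiCoeff (p ^ (0 + 1 + 1)) = 4 / (p : ℝ) - 1 := by
    simp only [pillaiCoeff, mul_moebius_prime_pow_succ _ hp, pow_zero, mul_moebius_one]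
    simp only [← pow_zero p, pillaiSq_prime_pow hp]
    push_cast
    field_simp
    ring
  simpa using h

lemma pillaiCoeff_prime_cube {p : ℕ} (hp : p.Prime) :
    pillaiCoeff (p ^ 3) = -(1 / (p : ℝ) ^ 2) := by
  have hp0 : (p : ℝ) ≠ 0 := by exact_mod_cast hp.ne_zero
  have h : pillaiCoeff (p ^ (0 + 1 + 1 + 1)) = -(1 / (p : ℝ) ^ 2) := by
    simp only [pillaiCoeff, mul_moebius_prime_pow_succ _ hp, pow_zero, mul_moebius_one]
    simp only [← pow_zero p, pillaiSq_prime_pow hp]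
    push_cast
    field_simp
    ring
  simpa using h

lemma pillaiCoeff_prime_pow_add_four {p : ℕ} (hp : p.Prime) (k : ℕ) :
    pillaiCoeff (p ^ (k + 4)) = 0 := by
  have h : pillaiCoeff (p ^ (k + 1 + 1 + 1 + 1)) = 0 := by
    simp only [pillaiCoeff, mul_moebius_prime_pow_succ _ hp]
    simp only [pillaiSq_prime_pow hp]
    push_cast
    ring
  exact h

/-- A nonnegative multiplicative function is summable if its local series are dominated by
`1 + b p` with `b` summable. -/
lemma summable_of_multiplicative_of_local_le {f b : ℕ → ℝ} (hf : ∀ n, 0 ≤ f n) (hf0 : f 0 = 0)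
    (hf1 : f 1 = 1) (hmul : ∀ {m n : ℕ}, Nat.Coprime m n → f (m * n) = f m * f n)
    (hloc : ∀ {p : ℕ}, p.Prime → Summable fun e => f (p ^ e))
    (hb0 : ∀ n, 0 ≤ b n) (hb : Summable b)
    (hle : ∀ {p : ℕ}, p.Prime → ∑' e, f (p ^ e) ≤ 1 + b p) : Summable f := by
  refine summable_of_sum_range_le (c := Real.exp (∑' n, b n)) hf fun n => ?_
  have hloc' : ∀ {p : ℕ}, p.Prime → Summable fun e => ‖f (p ^ e)‖ := fun hp => (hloc hp).norm
  obtain ⟨hs, hS⟩ :=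
    EulerProduct.summable_and_hasSum_smoothNumbers_prod_primesBelow_tsum hf1 hmul hloc' n
  have hS' := hasSum_subtype_iff_indicator.1 hS
  have h1 : ∑ i ∈ Finset.range n, f i ≤ ∏ p ∈ n.primesBelow, ∑' e, f (p ^ e) := by
    refine le_trans (Finset.sum_le_sum fun i hi => ?_)
      (sum_le_hasSum (Finset.range n) (fun i _ => ?_) hS')
    · rcases Nat.eq_zero_or_pos i with rfl | hi0
      · rw [hf0]; exact Set.indicator_nonneg (fun x _ => hf x) _
      · rw [Set.indicator_of_mem (Nat.mem_smoothNumbers_of_lt hi0 (Finset.mem_range.1 hi))]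
    · exact Set.indicator_nonneg (fun x _ => hf x) _
  refine h1.trans ?_
  have h2 : ∏ p ∈ n.primesBelow, ∑' e, f (p ^ e) ≤ ∏ p ∈ n.primesBelow, Real.exp (b p) := by
    refine Finset.prod_le_prod (fun p _ => tsum_nonneg fun e => hf _) fun p hp => ?_
    refine (hle (Nat.prime_of_mem_primesBelow hp)).trans ?_
    rw [add_comm]
    exact Real.add_one_le_exp _
  refine h2.trans ?_
  rw [← Real.exp_sum]
  exact Real.exp_le_exp.2 (hb.sum_le_tsum _ fun i _ => hb0 i)

lemma pillaiCoeff_div_mul {m n : ℕ} (h : Nat.Coprime m n) :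
    pillaiCoeff (m * n) / ((m * n : ℕ) : ℝ) = pillaiCoeff m / m * (pillaiCoeff n / n) := by
  rw [isMultiplicative_pillaiCoeff.map_mul_of_coprime h, Nat.cast_mul, mul_div_mul_comm]

lemma hasSum_of_eq_zero_of_four_le {f : ℕ → ℝ} (h : ∀ k, f (k + 4) = 0) :
    HasSum f (f 0 + f 1 + f 2 + f 3) := by
  have := hasSum_sum_of_ne_finset_zero (L := SummationFilter.unconditional ℕ) (f := f)
    (s := Finset.range 4) fun b hb => by
    obtain ⟨k, rfl⟩ := Nat.exists_eq_add_of_le (not_lt.1 (mt Finset.mem_range.2 hb))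
    rw [add_comm]; exact h k
  simpa [Finset.sum_range_succ] using this

lemma summable_pillaiCoeff_div : Summable fun n : ℕ => ‖pillaiCoeff n / n‖ := by
  have hloc : ∀ {p : ℕ}, p.Prime →
      HasSum (fun e : ℕ => ‖pillaiCoeff (p ^ e) / ((p ^ e : ℕ) : ℝ)‖)
        (1 + ‖pillaiCoeff p / p‖ + ‖pillaiCoeff (p ^ 2) / ((p ^ 2 : ℕ) : ℝ)‖ +
          ‖pillaiCoeff (p ^ 3) / ((p ^ 3 : ℕ) : ℝ)‖) := by
    intro p hp
    have := hasSum_of_eq_zero_of_four_le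
      (f := fun e : ℕ => ‖pillaiCoeff (p ^ e) / ((p ^ e : ℕ) : ℝ)‖)
      (fun k => by simp [pillaiCoeff_prime_pow_add_four hp])
    simpa [isMultiplicative_pillaiCoeff.map_one] using this
  refine summable_of_multiplicative_of_local_le (b := fun n => 11 * (1 / (n : ℝ) ^ 2))
    (fun n => norm_nonneg _) (by simp) (by simp [isMultiplicative_pillaiCoeff.map_one])
    (fun h => by rw [pillaiCoeff_div_mul h, norm_mul]) (fun hp => (hloc hp).summable)
    (fun n => by positivity)
    ((Real.summable_one_div_nat_pow.2 one_lt_two).mul_left 11) (fun {p} hp => ?_)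
  rw [(hloc hp).tsum_eq, pillaiCoeff_prime hp, pillaiCoeff_prime_sq hp, pillaiCoeff_prime_cube hp]
  have hp2 : (2 : ℝ) ≤ p := by exact_mod_cast hp.two_le
  have hx0 : 0 < 1 / (p : ℝ) := by positivity
  have hx1 : 1 / (p : ℝ) ≤ 1 / 2 := by
    exact one_div_le_one_div_of_le two_pos hp2
  have b1 : ‖(1 / (p : ℝ) ^ 2 - 4 / p) / p‖ ≤ 4 * (1 / (p : ℝ) ^ 2) := by
    have e : (1 / (p : ℝ) ^ 2 - 4 / p) / p = (1 / (p : ℝ) - 4) * (1 / (p : ℝ) ^ 2) := by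
      field_simp
    rw [e, norm_mul, Real.norm_of_nonneg (by positivity : 0 ≤ 1 / (p : ℝ) ^ 2)]
    refine mul_le_mul_of_nonneg_right ?_ (by positivity)
    rw [Real.norm_eq_abs, abs_le]
    constructor <;> linarith
  have b2 : ‖(4 / (p : ℝ) - 1) / ((p ^ 2 : ℕ) : ℝ)‖ ≤ 3 * (1 / (p : ℝ) ^ 2) := by
    have e : (4 / (p : ℝ) - 1) / ((p ^ 2 : ℕ) : ℝ) = (4 * (1 / (p : ℝ)) - 1) * (1 / (p : ℝ) ^ 2) := by
      push_cast; ring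
    rw [e, norm_mul, Real.norm_of_nonneg (by positivity : 0 ≤ 1 / (p : ℝ) ^ 2)]
    refine mul_le_mul_of_nonneg_right ?_ (by positivity)
    rw [Real.norm_eq_abs, abs_le]
    constructor <;> linarith
  have b3 : ‖-(1 / (p : ℝ) ^ 2) / ((p ^ 3 : ℕ) : ℝ)‖ ≤ 1 * (1 / (p : ℝ) ^ 2) := by
    have e : -(1 / (p : ℝ) ^ 2) / ((p ^ 3 : ℕ) : ℝ) = -(1 / (p : ℝ)) ^ 3 * (1 / (p : ℝ) ^ 2) := by
      push_cast; ring
    rw [e, norm_mul, Real.norm_of_nonneg (by positivity : 0 ≤ 1 / (p : ℝ) ^ 2)]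
    refine mul_le_mul_of_nonneg_right ?_ (by positivity)
    rw [norm_neg, Real.norm_of_nonneg (by positivity)]
    exact pow_le_one₀ hx0.le (by linarith)
  have hq : 0 ≤ 1 / (p : ℝ) ^ 2 := by positivity
  linarith

lemma tprod_eq_tsum_pillaiCoeff_div :
    ∏' p : Nat.Primes,
      (1 - 5 / ((p : ℕ) : ℝ) ^ 2 + 5 / ((p : ℕ) : ℝ) ^ 3 - 1 / ((p : ℕ) : ℝ) ^ 5) =
      ∑' n : ℕ, pillaiCoeff n / n := by
  have h := EulerProduct.eulerProduct_hasProd (f := fun n : ℕ => pillaiCoeff n / n)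
    (by simp [isMultiplicative_pillaiCoeff.map_one]) (fun h => pillaiCoeff_div_mul h)
    summable_pillaiCoeff_div (by simp)
  rw [← h.tprod_eq]
  refine tprod_congr fun p => ?_
  have hp := p.2
  have hp0 : ((p : ℕ) : ℝ) ≠ 0 := by exact_mod_cast hp.ne_zero
  have := hasSum_of_eq_zero_of_four_le
    (f := fun e : ℕ => pillaiCoeff ((p : ℕ) ^ e) / (((p : ℕ) ^ e : ℕ) : ℝ))
    (fun k => by simp [pillaiCoeff_prime_pow_add_four hp])
  rw [this.tsum_eq, pow_one, pow_zero, isMultiplicative_pillaiCoeff.map_one, pillaiCoeff_prime hp,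
    pillaiCoeff_prime_sq hp, pillaiCoeff_prime_cube hp]
  push_cast
  field_simp
  ring

lemma sum_pillai_sq_eq (n : ℕ) :
    ∑ k ∈ Finset.Icc 1 n, ((pillai k : ℝ) / (k : ℝ)) ^ 2 =
      ∑' a : ℕ, pillaiCoeff a * divisorSum 4 (n / a) := by
  have e : Finset.Icc 1 n = Finset.Ioc 0 n := by ext; simp; omega
  rw [e, Finset.sum_congr rfl fun k hk => (pillaiSq_apply (Finset.mem_Ioc.1 hk).1).symm,
    ← pillaiCoeff_mul_zeta_pow, sum_Ioc_mul_eq_sum_sum]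
  rw [tsum_eq_sum (s := Finset.Ioc 0 n)]
  · refine Finset.sum_congr rfl fun a _ => ?_
    rw [divisorSum, Nat.floor_div_eq_div]
  · intro a ha
    rw [divisorSum, Nat.floor_div_eq_div]
    rcases Nat.eq_zero_or_pos a with rfl | ha0
    · simp
    · rw [Nat.div_eq_of_lt (by simp only [Finset.mem_Ioc, not_and, not_le] at ha; exact ha ha0)]
      simp

lemma tendsto_divisorSum_four_div {a : ℕ} (ha : 0 < a) :
    Tendsto (fun n : ℕ => divisorSum 4 (n / a) / (n * Real.log n ^ 3)) atTop
      (nhds (1 / 6 * (1 / a))) := by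
  have ha0 : (0 : ℝ) < a := by exact_mod_cast ha
  have h1 : Tendsto (fun n : ℕ => (n : ℝ) / a) atTop atTop :=
    tendsto_natCast_atTop_atTop.atTop_div_const ha0
  have hlog : Tendsto (fun n : ℕ => Real.log (n : ℝ)) atTop atTop :=
    Real.tendsto_log_atTop.comp tendsto_natCast_atTop_atTop
  have h2 : Tendsto (fun n : ℕ => 1 - Real.log a * (Real.log n)⁻¹) atTop (nhds 1) := by
    have := ((tendsto_inv_atTop_zero.comp hlog).const_mul (Real.log a)).const_sub 1
    simpa using this
  have h3 := ((tendsto_divisorSum_four.comp h1).mul (h2.pow 3)).mul_const (1 / (a : ℝ))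
  rw [one_pow, mul_one] at h3
  refine h3.congr' ?_
  filter_upwards [hlog.eventually_gt_atTop 0,
    (Real.tendsto_log_atTop.comp h1).eventually_gt_atTop 0, eventually_gt_atTop 0] with n hn hna hn0
  have hn0' : (0 : ℝ) < n := by exact_mod_cast hn0
  simp only [Function.comp_apply] at hna ⊢
  have e : 1 - Real.log a * (Real.log n)⁻¹ = Real.log (n / a) / Real.log n := by
    rw [Real.log_div hn0'.ne' ha0.ne']
    field_simp
  rw [e]
  field_simp

lemma divisorSum_four_div_le {n a : ℕ} (ha : 0 < a) (hn : 1 ≤ Real.log n) :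
    divisorSum 4 (n / a) / (n * Real.log n ^ 3) ≤ 64 / a := by
  have ha0 : (0 : ℝ) < a := by exact_mod_cast ha
  have hn0 : (0 : ℝ) < n := by
    rcases Nat.eq_zero_or_pos n with rfl | h
    · norm_num at hn
    · exact_mod_cast h
  have hl : 0 < Real.log n := by linarith
  rw [div_le_iff₀ (by positivity)]
  rcases lt_or_ge ((n : ℝ) / a) 1 with h | h
  · have : divisorSum 4 (n / a) = 0 := by simp [divisorSum, Nat.floor_eq_zero.2 h]
    rw [this]
    positivity
  · refine (divisorSum_succ_le h 3).trans ?_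
    have h1 : Real.log (n / a) ≤ Real.log n :=
      Real.log_le_log (by positivity) (div_le_self hn0.le (by exact_mod_cast ha))
    have h0 : 0 ≤ Real.log (n / a) := Real.log_nonneg h
    have h2 : (Real.log (n / a) + (3 : ℕ)) ^ 3 ≤ (4 * Real.log n) ^ 3 := by
      gcongr
      push_cast
      linarith
    have h3 : (Real.log (n / a) + (3 : ℕ)) ^ 3 / (Nat.factorial 3 : ℝ) ≤ 64 * Real.log n ^ 3 := by
      rw [div_le_iff₀ (by positivity)]
      refine h2.trans ?_
      norm_num [Nat.factorial]
      have := pow_pos hl 3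
      ring_nf
      linarith
    refine (mul_le_mul_of_nonneg_left h3 (by positivity)).trans (le_of_eq ?_)
    field_simp

lemma tendsto_pillai_sq_average :
    Tendsto (fun n : ℕ => (1 / Real.log n ^ 3) *
      ((1 / (n : ℝ)) * ∑ k ∈ Finset.Icc 1 n, ((pillai k : ℝ) / (k : ℝ)) ^ 2)) atTop
      (nhds (∑' a : ℕ, pillaiCoeff a * (1 / 6 * (1 / (a : ℝ))))) := by
  have hT : Tendsto (fun n : ℕ => ∑' a : ℕ,
      pillaiCoeff a * (divisorSum 4 (n / a) / (n * Real.log n ^ 3))) atTop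
      (nhds (∑' a : ℕ, pillaiCoeff a * (1 / 6 * (1 / (a : ℝ))))) := by
    refine tendsto_tsum_of_dominated_convergence
      (summable_pillaiCoeff_div.mul_left 64) (fun a => ?_) ?_
    · rcases Nat.eq_zero_or_pos a with rfl | ha
      · simp
      · exact (tendsto_divisorSum_four_div ha).const_mul _
    · have hlog : Tendsto (fun n : ℕ => Real.log (n : ℝ)) atTop atTop :=
        Real.tendsto_log_atTop.comp tendsto_natCast_atTop_atTop
      filter_upwards [hlog.eventually_ge_atTop 1] with n hn a
      rcases Nat.eq_zero_or_pos a with rfl | ha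
      · simp
      · have h := divisorSum_four_div_le ha hn
        have h0 : 0 ≤ divisorSum 4 (n / a) / (n * Real.log n ^ 3) := by
          have := divisorSum_nonneg 4 ((n : ℝ) / a)
          positivity
        rw [norm_mul, Real.norm_of_nonneg h0, norm_div, RCLike.norm_natCast]
        refine (mul_le_mul_of_nonneg_left h (norm_nonneg _)).trans (le_of_eq ?_)
        ring
  refine hT.congr fun n => ?_
  rw [sum_pillai_sq_eq, ← mul_assoc, ← tsum_mul_left]
  refine tsum_congr fun a => ?_
  rw [one_div_mul_one_div, mul_comm (n : ℝ)]
  ring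

lemma deltaConst_le_liminf :
    DeltaConst ≤ liminf (fun n : ℕ => (1 / Real.log n ^ 3) *
      ((1 / (n : ℝ)) * ∑ k ∈ Finset.Icc 1 n, ((pillai k : ℝ) / (k : ℝ)) ^ 2)) atTop := by
  have h := tendsto_pillai_sq_average
  have e : ∑' a : ℕ, pillaiCoeff a * (1 / 6 * (1 / (a : ℝ))) = 2 * DeltaConst := by
    rw [DeltaConst, tprod_eq_tsum_pillaiCoeff_div, ← tsum_mul_left, ← tsum_mul_left]
    refine tsum_congr fun a => ?_
    ring
  rw [e] at h
  have h0 : 0 ≤ 2 * DeltaConst := ge_of_tendsto h <| Eventually.of_forall fun n => by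
    have : 0 ≤ Real.log n := Real.log_natCast_nonneg n
    positivity
  rw [h.liminf_eq]
  linarith

lemma sum_pillaiPow_sq_eq (s n : ℕ) :
    ∑ k ∈ Finset.Icc 1 n, ((pillaiPow s k : ℝ) / (k : ℝ) ^ s) ^ 2 =
      ∑ x ∈ Finset.Icc 1 n ×ˢ Finset.Icc 1 n,
        (Nat.totient x.1 : ℝ) / (x.1 : ℝ) ^ s * ((Nat.totient x.2 : ℝ) / (x.2 : ℝ) ^ s) *
          ((n / Nat.lcm x.1 x.2 : ℕ) : ℝ) := by
  have h1 : ∀ k ∈ Finset.Icc 1 n, ((pillaiPow s k : ℝ) / (k : ℝ) ^ s) ^ 2 =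
      ∑ x ∈ Finset.Icc 1 n ×ˢ Finset.Icc 1 n, if Nat.lcm x.1 x.2 ∣ k then
        (Nat.totient x.1 : ℝ) / (x.1 : ℝ) ^ s * ((Nat.totient x.2 : ℝ) / (x.2 : ℝ) ^ s)
        else 0 := by
    intro k hk
    have hk' := Finset.mem_Icc.1 hk
    rw [pillaiPow_div_pow s hk'.1, sq, Finset.sum_mul_sum, ← Finset.sum_product',
      ← Finset.sum_filter]
    refine Finset.sum_congr ?_ fun _ _ => rfl
    ext ⟨i, j⟩
    simp only [Finset.mem_product, Nat.mem_divisors, Finset.mem_filter, Finset.mem_Icc,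
      Nat.lcm_dvd_iff]
    constructor
    · rintro ⟨⟨hi, -⟩, hj, -⟩
      have := Nat.le_of_dvd hk'.1 hi
      have := Nat.le_of_dvd hk'.1 hj
      have := Nat.pos_of_dvd_of_pos hi hk'.1
      have := Nat.pos_of_dvd_of_pos hj hk'.1
      exact ⟨by omega, hi, hj⟩
    · rintro ⟨-, hi, hj⟩
      exact ⟨⟨hi, by omega⟩, hj, by omega⟩
  rw [Finset.sum_congr rfl h1, Finset.sum_comm]
  refine Finset.sum_congr rfl fun x _ => ?_
  have e : Finset.Icc 1 n = Finset.Ioc 0 n := by ext; simp; omega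
  rw [← Finset.sum_filter, Finset.sum_const, e, Nat.Ioc_filter_dvd_card_eq_div, nsmul_eq_mul,
    mul_comm]

lemma totient_div_pow_le (s i : ℕ) (hs : 2 ≤ s) (hi : 0 < i) :
    (Nat.totient i : ℝ) / (i : ℝ) ^ s ≤ 1 / i := by
  have hi1 : (1 : ℝ) ≤ i := by exact_mod_cast hi
  rw [div_le_div_iff₀ (by positivity) (by positivity), one_mul]
  calc (Nat.totient i : ℝ) * i ≤ i * i := by gcongr; exact_mod_cast Nat.totient_le i
    _ = (i : ℝ) ^ 2 := by ring
    _ ≤ (i : ℝ) ^ s := pow_le_pow_right₀ hi1 hs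

lemma gcd_le_rpow_half_mul {i j : ℕ} (hi : 0 < i) (hj : 0 < j) :
    (Nat.gcd i j : ℝ) ≤ (i : ℝ) ^ (1 / 2 : ℝ) * (j : ℝ) ^ (1 / 2 : ℝ) := by
  have h1 : (Nat.gcd i j : ℝ) ≤ i := by exact_mod_cast Nat.gcd_le_left j hi
  have h2 : (Nat.gcd i j : ℝ) ≤ j := by exact_mod_cast Nat.gcd_le_right i hj
  rw [← Real.sqrt_eq_rpow, ← Real.sqrt_eq_rpow, ← Real.sqrt_mul (by positivity)]
  refine Real.le_sqrt_of_sq_le ?_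
  rw [sq]
  exact mul_le_mul h1 h2 (by positivity) (by positivity)

lemma totient_mul_totient_div_lcm_le {s i j : ℕ} (hs : 2 ≤ s) (hi : 0 < i) (hj : 0 < j) :
    (Nat.totient i : ℝ) / (i : ℝ) ^ s * ((Nat.totient j : ℝ) / (j : ℝ) ^ s) *
      (1 / (Nat.lcm i j : ℝ)) ≤ 1 / (i : ℝ) ^ (3 / 2 : ℝ) * (1 / (j : ℝ) ^ (3 / 2 : ℝ)) := by
  have hi0 : (0 : ℝ) < i := by exact_mod_cast hi
  have hj0 : (0 : ℝ) < j := by exact_mod_cast hj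
  have hl : (Nat.lcm i j : ℝ) ≠ 0 := by exact_mod_cast (Nat.lcm_pos hi hj).ne'
  have e : 1 / (Nat.lcm i j : ℝ) = (Nat.gcd i j : ℝ) / (i * j) := by
    rw [div_eq_div_iff hl (by positivity), one_mul]
    exact_mod_cast (Nat.gcd_mul_lcm i j).symm
  have e3 : ∀ x : ℝ, 0 < x → 1 / x ^ (3 / 2 : ℝ) = 1 / x * (x ^ (1 / 2 : ℝ) / x) := by
    intro x hx
    rw [show (3 / 2 : ℝ) = 2 - 1 / 2 by norm_num, Real.rpow_sub hx, Real.rpow_two]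
    field_simp
  rw [e, e3 i hi0, e3 j hj0]
  calc _ ≤ 1 / (i : ℝ) * (1 / j) * ((i : ℝ) ^ (1 / 2 : ℝ) * (j : ℝ) ^ (1 / 2 : ℝ) / (i * j)) := by
        refine mul_le_mul (mul_le_mul (totient_div_pow_le s i hs hi)
          (totient_div_pow_le s j hs hj) (by positivity) (by positivity)) ?_
          (by positivity) (by positivity)
        exact div_le_div_of_nonneg_right (gcd_le_rpow_half_mul hi hj) (by positivity)
    _ = _ := by ring

lemma tendsto_natCast_div_div (m : ℕ) :
    Tendsto (fun n : ℕ => ((n / m : ℕ) : ℝ) / n) atTop (nhds (1 / (m : ℝ))) := by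
  have h := (tendsto_nat_floor_mul_div_atTop (R := ℝ) (a := 1 / (m : ℝ)) (by positivity)).comp
    tendsto_natCast_atTop_atTop (α := ℕ)
  refine h.congr fun n => ?_
  rw [Function.comp_apply, one_div_mul_eq_div, Nat.floor_div_eq_div]

lemma tendsto_pillaiPow_sq_average {s : ℕ} (hs : 2 ≤ s) :
    Tendsto (fun n : ℕ =>
        (1 / (n : ℝ)) * ∑ k ∈ Finset.Icc 1 n, ((pillaiPow s k : ℝ) / (k : ℝ) ^ s) ^ 2)
      atTop (nhds (Mconst s)) := by
  set c : ℕ+ × ℕ+ → ℝ := fun x =>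
    (Nat.totient x.1 : ℝ) / (x.1 : ℝ) ^ s * ((Nat.totient x.2 : ℝ) / (x.2 : ℝ) ^ s) with hc
  have hc0 : ∀ x, 0 ≤ c x := fun x => by simp only [hc]; positivity
  have hM : Mconst s = ∑' x : ℕ+ × ℕ+, c x * (1 / (Nat.lcm x.1 x.2 : ℝ)) := by
    refine tsum_congr fun x => ?_
    have hi : ((x.1 : ℕ) : ℝ) ≠ 0 := by exact_mod_cast x.1.pos.ne'
    have hj : ((x.2 : ℕ) : ℝ) ≠ 0 := by exact_mod_cast x.2.pos.ne'
    have hl : (Nat.lcm x.1 x.2 : ℝ) ≠ 0 := by exact_mod_cast (Nat.lcm_pos x.1.pos x.2.pos).ne'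
    have hg : (Nat.gcd x.1 x.2 : ℝ) * (Nat.lcm x.1 x.2 : ℝ) = (x.1 : ℕ) * (x.2 : ℕ) := by
      exact_mod_cast Nat.gcd_mul_lcm x.1 x.2
    simp only [hc]
    rw [pow_add, pow_add, pow_one, pow_one]
    field_simp
    exact hg
  have hsum : Summable fun x : ℕ+ × ℕ+ =>
      1 / ((x.1 : ℕ) : ℝ) ^ (3 / 2 : ℝ) * (1 / ((x.2 : ℕ) : ℝ) ^ (3 / 2 : ℝ)) := by
    have h1 : Summable fun i : ℕ+ => 1 / ((i : ℕ) : ℝ) ^ (3 / 2 : ℝ) :=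
      (Real.summable_one_div_nat_rpow.2 (by norm_num)).comp_injective PNat.coe_injective
    exact h1.mul_of_nonneg h1 (fun i => by positivity) (fun i => by positivity)
  have hT : Tendsto (fun n : ℕ => ∑' x : ℕ+ × ℕ+,
      c x * (((n / Nat.lcm x.1 x.2 : ℕ) : ℝ) / n)) atTop (nhds (Mconst s)) := by
    rw [hM]
    refine tendsto_tsum_of_dominated_convergence hsum
      (fun x => (tendsto_natCast_div_div _).const_mul _) (Eventually.of_forall fun n x => ?_)
    rw [Real.norm_of_nonneg (mul_nonneg (hc0 x) (by positivity))]
    refine le_trans (mul_le_mul_of_nonneg_left ?_ (hc0 x))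
      (totient_mul_totient_div_lcm_le hs x.1.pos x.2.pos)
    rcases Nat.eq_zero_or_pos n with rfl | hn
    · simp
    · have hn0 : (0 : ℝ) < n := by exact_mod_cast hn
      rw [div_le_iff₀ hn0, one_div_mul_eq_div]
      exact Nat.cast_div_le
  refine hT.congr fun n => ?_
  rw [sum_pillaiPow_sq_eq, Finset.mul_sum]
  set F : ℕ × ℕ → ℝ := fun x => 1 / (n : ℝ) *
    ((Nat.totient x.1 : ℝ) / (x.1 : ℝ) ^ s * ((Nat.totient x.2 : ℝ) / (x.2 : ℝ) ^ s) *
      ((n / Nat.lcm x.1 x.2 : ℕ) : ℝ)) with hF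
  have hinj : Function.Injective fun x : ℕ+ × ℕ+ => ((x.1 : ℕ), (x.2 : ℕ)) :=
    PNat.coe_injective.prodMap PNat.coe_injective
  have hsupp : ∀ x ∉ Finset.Icc 1 n ×ˢ Finset.Icc 1 n, F x = 0 := by
    rintro ⟨i, j⟩ hx
    simp only [hF]
    rcases Nat.eq_zero_or_pos i with rfl | hi
    · simp
    rcases Nat.eq_zero_or_pos j with rfl | hj
    · simp
    have hlt : n < Nat.lcm i j := by
      have h1 := Nat.le_of_dvd (Nat.lcm_pos hi hj) (Nat.dvd_lcm_left i j)
      have h2 := Nat.le_of_dvd (Nat.lcm_pos hi hj) (Nat.dvd_lcm_right i j)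
      simp only [Finset.mem_product, Finset.mem_Icc] at hx
      omega
    simp [Nat.div_eq_of_lt hlt]
  have h1 : ∑' x : ℕ+ × ℕ+, F ((x.1 : ℕ), (x.2 : ℕ)) = ∑' x, F x := by
    refine hinj.tsum_eq fun x hx => ?_
    have hx' : x ∈ Finset.Icc 1 n ×ˢ Finset.Icc 1 n := by
      by_contra h
      exact hx (hsupp x h)
    simp only [Finset.mem_product, Finset.mem_Icc] at hx'
    exact ⟨(⟨x.1, hx'.1.1⟩, ⟨x.2, hx'.2.1⟩), rfl⟩
  rw [← tsum_eq_sum (L := SummationFilter.unconditional (ℕ × ℕ)) hsupp, ← h1]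
  refine tsum_congr fun x => ?_
  simp only [hF, hc]
  ring

/-- (a) `liminf_{n→∞} (ln n)⁻³ (1/n) Σ_{k≤n} (P(k)/k)² ≥ Δ`; (b) for each fixed integer
`s ≥ 2`, `(1/n) Σ_{k≤n} (P_s(k)/k^s)² → M(s)` as `n → ∞`. -/
theorem pillai_square_averages :
    DeltaConst ≤ liminf (fun n : ℕ =>
        (1 / Real.log n ^ 3) *
          ((1 / (n : ℝ)) * ∑ k ∈ Finset.Icc 1 n, ((pillai k : ℝ) / (k : ℝ)) ^ 2)) atTop ∧
    ∀ s : ℕ, 2 ≤ s →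
      Tendsto (fun n : ℕ =>
          (1 / (n : ℝ)) * ∑ k ∈ Finset.Icc 1 n, ((pillaiPow s k : ℝ) / (k : ℝ) ^ s) ^ 2)
        atTop (nhds (Mconst s)) := by
  exact ⟨deltaConst_le_liminf, fun s hs => tendsto_pillaiPow_sq_average hs⟩
end

section
/- (Cesàro's formulas.) Let F be any arithmetic function and let μ*F denote its Dirichlet convolution with the Möbius function μ. Then: (a) for all integers n, r ≥ 1, Σ_{1≤x_1,…,x_r≤n} F(gcd(x_1,…,x_r)) = Σ_{j=1}^n (μ*F)(j)·⌊n/j⌋^r; and (b) for all integers r ≥ 1 and 1 ≤ k ≤ n, Σ_{1≤x_1,…,x_r≤n} F(gcd(x_1,…,x_r,k)) = Σ_{j|k} (μ*F)(j)·⌊n/j⌋^r, where the last sum runs over the divisors j of k. -/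
/-- The Dirichlet convolution `μ * F` of the Möbius function with an arithmetic function `F`. -/
noncomputable def moebiusConv (F : ℕ → ℝ) (j : ℕ) : ℝ :=
  ∑ d ∈ j.divisors, ((ArithmeticFunction.moebius d : ℤ) : ℝ) * F (j / d)

theorem sum_divisors_moebiusConv (F : ℕ → ℝ) {m : ℕ} (hm : 0 < m) :
    ∑ d ∈ m.divisors, moebiusConv F d = F m := by
  refine (ArithmeticFunction.sum_eq_iff_sum_mul_moebius_eq (f := moebiusConv F)).2 ?_ m hm
  intro k _
  rw [Nat.sum_divisorsAntidiagonal
    (fun a b => ((ArithmeticFunction.moebius a : ℤ) : ℝ) * F b)]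
  rfl

theorem card_filter_piFinset_Icc_dvd (n r j : ℕ) :
    ((Fintype.piFinset fun _ : Fin r => Finset.Icc 1 n).filter
      fun x => ∀ i, j ∣ x i).card = (n / j) ^ r := by
  have h : (Fintype.piFinset fun _ : Fin r => Finset.Icc 1 n).filter (fun x => ∀ i, j ∣ x i) =
      Fintype.piFinset fun _ : Fin r => (Finset.Ioc 0 n).filter (j ∣ ·) := by
    ext x
    simp only [Finset.mem_filter, Fintype.mem_piFinset, Finset.mem_Icc, Finset.mem_Ioc,
      Nat.succ_le_iff, forall_and]
  rw [h, Fintype.card_piFinset_const, Nat.Ioc_filter_dvd_card_eq_div]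

/-- If the divisors of `g x` are the elements of `S` dividing every coordinate of `x`, then
summing `F ∘ g` over a box reduces to a sum over `S`. -/
theorem sum_piFinset_Icc_eq_sum_moebiusConv (F : ℕ → ℝ) (n r : ℕ) (S : Finset ℕ)
    (g : (Fin r → ℕ) → ℕ)
    (hpos : ∀ x ∈ Fintype.piFinset (fun _ : Fin r => Finset.Icc 1 n), 0 < g x)
    (hdiv : ∀ x ∈ Fintype.piFinset (fun _ : Fin r => Finset.Icc 1 n),
      (g x).divisors = S.filter fun j => ∀ i, j ∣ x i) :
    ∑ x ∈ Fintype.piFinset (fun _ : Fin r => Finset.Icc 1 n), F (g x) =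
      ∑ j ∈ S, moebiusConv F j * ((n / j : ℕ) : ℝ) ^ r := by
  calc
    _ = ∑ x ∈ Fintype.piFinset (fun _ : Fin r => Finset.Icc 1 n),
          ∑ j ∈ S, if ∀ i, j ∣ x i then moebiusConv F j else 0 :=
      Finset.sum_congr rfl fun x hx => by
        rw [← sum_divisors_moebiusConv F (hpos x hx), hdiv x hx, Finset.sum_filter]
    _ = _ := by
      rw [Finset.sum_comm]
      refine Finset.sum_congr rfl fun j _ => ?_
      rw [← Finset.sum_filter, Finset.sum_const, card_filter_piFinset_Icc_dvd, nsmul_eq_mul,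
        Nat.cast_pow, mul_comm]

/-- **Cesàro's formulas.** For any arithmetic function `F`:
(a) `Σ_{1≤x₁,…,x_r≤n} F(gcd(x₁,…,x_r)) = Σ_{j=1}^n (μ*F)(j) ⌊n/j⌋^r`, and
(b) for `1 ≤ k ≤ n`, `Σ_{1≤x₁,…,x_r≤n} F(gcd(x₁,…,x_r,k)) = Σ_{j∣k} (μ*F)(j) ⌊n/j⌋^r`. -/
theorem cesaro_formulas (F : ℕ → ℝ) :
    (∀ n r : ℕ, 1 ≤ n → 1 ≤ r →
      ∑ x ∈ Fintype.piFinset (fun _ : Fin r => Finset.Icc 1 n), F (Finset.univ.gcd x) =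
        ∑ j ∈ Finset.Icc 1 n, moebiusConv F j * ((n / j : ℕ) : ℝ) ^ r) ∧
    (∀ n r k : ℕ, 1 ≤ r → 1 ≤ k → k ≤ n →
      ∑ x ∈ Fintype.piFinset (fun _ : Fin r => Finset.Icc 1 n),
          F (Nat.gcd (Finset.univ.gcd x) k) =
        ∑ j ∈ k.divisors, moebiusConv F j * ((n / j : ℕ) : ℝ) ^ r) := by
  refine ⟨fun n r _ hr => ?_, fun n r k _ hk _ => ?_⟩
  · have hpos : ∀ x ∈ Fintype.piFinset (fun _ : Fin r => Finset.Icc 1 n),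
        0 < Finset.univ.gcd x := fun x hx => by
      have hx0 := (Finset.mem_Icc.1 (Fintype.mem_piFinset.1 hx ⟨0, hr⟩)).1
      exact Nat.pos_of_dvd_of_pos (Finset.gcd_dvd (Finset.mem_univ _)) hx0
    refine sum_piFinset_Icc_eq_sum_moebiusConv F n r _ _ hpos fun x hx => ?_
    ext j
    have hx0 := Finset.mem_Icc.1 (Fintype.mem_piFinset.1 hx ⟨0, hr⟩)
    simp only [Nat.mem_divisors, Finset.dvd_gcd_iff, Finset.mem_univ, true_imp_iff,
      Finset.mem_filter, Finset.mem_Icc, (hpos x hx).ne', ne_eq, not_false_eq_true, and_true]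
    refine ⟨fun h => ⟨?_, h⟩, And.right⟩
    exact ⟨Nat.pos_of_dvd_of_pos (h _) hx0.1, (Nat.le_of_dvd hx0.1 (h _)).trans hx0.2⟩
  · refine sum_piFinset_Icc_eq_sum_moebiusConv F n r _ _
      (fun x _ => Nat.gcd_pos_of_pos_right _ hk) fun x _ => ?_
    ext j
    have hk0 : k ≠ 0 := Nat.ne_of_gt hk
    simp [Nat.dvd_gcd_iff, Finset.dvd_gcd_iff, hk0, and_comm]
end
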